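/- arXiv:1805.02945 — 2 statements merged into one kernel-verified Lean document; each statement's English description precedes it below -/
import Mathlib

section
/- Let (u_n) be defined by u₀ = 1 and u_{n+1} = u_n(u_n + 1), and let c₀ be the limit of u_n^(2^{-n}) as n → ∞. For an integer k ≥ 1 let S(k) denote the number of k-tuples (a₁,...,a_k) of positive integers with a₁ ≤ ... ≤ a_k satisfying 1 = Σ_{i=1}^k 1/a_i + 1/(a₁·a₂·…·a_k). Then for every ε > 0 there exists K = K(ε) such that for all k ≥ K, S(k) ≤ c₀^( (7/17 + ε) · 2^k ). -/
/-- The sequence u₀ = 1, u_{n+1} = u_n (u_n + 1). -/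
def u : ℕ → ℕ
  | 0 => 1
  | n + 1 => u n * (u n + 1)

/-- `S k` is the number of nondecreasing `k`-tuples of positive integers
`(a₁, …, a_k)` with `1 = 1/a₁ + ⋯ + 1/a_k + 1/(a₁a₂⋯a_k)`. -/
noncomputable def S (k : ℕ) : ℕ :=
  Nat.card {a : Fin k → ℕ // (∀ i, 0 < a i) ∧ Monotone a ∧
    (1 : ℚ) = (∑ i, (1 : ℚ) / a i) + 1 / (∏ i, (a i : ℚ))}

open Finset

lemma u_pos (n : ℕ) : 0 < u n := by
  induction n with
  | zero => simp [u]
  | succ n ih => simp only [u]; positivity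

lemma u_prod (n : ℕ) : ∏ i ∈ range n, ((u i : ℝ) + 1) = u n := by
  induction n with
  | zero => simp [u]
  | succ n ih => rw [prod_range_succ, ih]; simp [u]

lemma u_sum (n : ℕ) : ∑ i ∈ range n, 1 / ((u i : ℝ) + 1) = 1 - 1 / u n := by
  induction n with
  | zero => simp [u]
  | succ n ih =>
    rw [sum_range_succ, ih]
    have : (0 : ℝ) < u n := by exact_mod_cast u_pos n
    simp only [u]; push_cast
    field_simp
    ring

lemma abel_aux (y L : ℕ → ℝ) (hy : Antitone y) (n : ℕ)
    (h : ∀ i ≤ n, 0 ≤ ∑ j ∈ range i, L j) :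
    y n * ∑ j ∈ range n, L j ≤ ∑ j ∈ range n, y j * L j := by
  induction n with
  | zero => simp
  | succ n ih =>
    have h1 := ih (fun i hi => h i (by omega))
    have h2 := h (n + 1) le_rfl
    have h3 : y (n + 1) ≤ y n := hy (by omega)
    have h4 := mul_le_mul_of_nonneg_right h3 h2
    refine h4.trans ?_
    rw [sum_range_succ, sum_range_succ, mul_add]
    linarith

lemma gap_int (a : ℕ → ℕ) (ha : ∀ i, 0 < a i) (n : ℕ) :
    ∃ z : ℤ, (∏ i ∈ range n, (a i : ℝ)) * (1 - ∑ i ∈ range n, 1 / (a i : ℝ)) = z := by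
  induction n with
  | zero => exact ⟨1, by simp⟩
  | succ n ih =>
    obtain ⟨z, hz⟩ := ih
    refine ⟨z * a n - ∏ i ∈ range n, (a i : ℤ), ?_⟩
    have : (a n : ℝ) ≠ 0 := by exact_mod_cast (ha n).ne'
    push_cast
    rw [← hz, prod_range_succ, sum_range_succ]
    field_simp
    ring

lemma curtiss (a : ℕ → ℕ) (ha : ∀ i, 0 < a i) (hm : Monotone a) (n : ℕ) :
    ∑ i ∈ range n, 1 / (a i : ℝ) < 1 → ∑ i ∈ range n, 1 / (a i : ℝ) ≤ 1 - 1 / (u n : ℝ) := by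
  induction n using Nat.strong_induction_on with
  | _ n ih =>
  intro hlt
  have haR : ∀ i, (0 : ℝ) < a i := fun i => by exact_mod_cast ha i
  have huR : ∀ i, (0 : ℝ) < u i := fun i => by exact_mod_cast u_pos i
  by_contra! hcon
  rcases Nat.eq_zero_or_pos n with rfl | hn
  · simp [u] at hcon
  obtain ⟨z, hz⟩ := gap_int a ha n
  have hP : 0 < ∏ i ∈ range n, (a i : ℝ) := prod_pos fun i _ => haR i
  have hz1 : (1 : ℝ) ≤ z := by
    have : (0 : ℝ) < z := by rw [← hz]; exact mul_pos hP (by linarith)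
    have : 0 < z := by exact_mod_cast this
    exact_mod_cast this
  have hPu : (u n : ℝ) ≤ ∏ i ∈ range n, (a i : ℝ) := by
    have h1 : 1 - ∑ i ∈ range n, 1 / (a i : ℝ) ≤ 1 / u n := by linarith
    have h2 := mul_le_mul_of_nonneg_left h1 hP.le
    rw [hz] at h2
    have h3 := hz1.trans h2
    rwa [mul_one_div, le_div_iff₀ (huR n), one_mul] at h3
  set L : ℕ → ℝ := fun j => Real.log (a j / (u j + 1)) with hL
  set F : ℕ → ℝ := fun i => ∑ j ∈ range i, L j with hF
  have hFn : F 0 ≤ F n := by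
    simp only [hF, range_zero, sum_empty, hL]
    rw [← Real.log_prod (fun i _ => (div_pos (haR i) (by have := huR i; linarith)).ne')]
    apply Real.log_nonneg
    rw [prod_div_distrib, u_prod, le_div_iff₀ (huR n), one_mul]
    exact hPu
  classical
  obtain ⟨k, hkn, hk1, hk2⟩ : ∃ k < n, F k ≤ F n ∧ ∀ i, k < i → i < n → F n < F i := by
    refine ⟨Nat.findGreatest (fun i => F i ≤ F n) (n - 1), ?_, ?_, ?_⟩
    · have := Nat.findGreatest_le (P := fun i => F i ≤ F n) (n - 1); omega
    · exact Nat.findGreatest_spec (P := fun i => F i ≤ F n) (Nat.zero_le (n - 1)) hFn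
    · intro i hi hin
      have := Nat.findGreatest_is_greatest hi (by omega)
      exact not_le.mp this
  have hsplit : ∀ (f : ℕ → ℝ) (i : ℕ), ∑ j ∈ range (k + i), f j
      = ∑ j ∈ range k, f j + ∑ j ∈ range i, f (k + j) := fun f i => sum_range_add f k i
  obtain ⟨m, rfl⟩ : ∃ m, n = k + m := ⟨n - k, by omega⟩
  have hab := abel_aux (fun j => 1 / (a (k + j) : ℝ)) (fun j => L (k + j))
    (by
      intro i j hij
      apply one_div_le_one_div_of_le (haR _)
      exact_mod_cast hm (by omega)) m
    (by
      intro i hi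
      have h1 := hsplit L i
      change F (k + i) = F k + _ at h1
      have h2 : F k ≤ F (k + i) := by
        rcases Nat.eq_zero_or_pos i with rfl | h0
        · simp
        rcases hi.eq_or_lt with rfl | hlt
        · exact hk1
        · exact hk1.trans (hk2 _ (by omega) (by omega)).le
      linarith)
  have hLm : 0 ≤ ∑ j ∈ range m, L (k + j) := by
    have h1 := hsplit L m
    change F (k + m) = F k + _ at h1
    linarith
  have hab2 : 0 ≤ ∑ j ∈ range m, 1 / (a (k + j) : ℝ) * L (k + j) :=
    le_trans (mul_nonneg (by positivity) hLm) hab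
  have hterm : ∑ j ∈ range m, 1 / (a (k + j) : ℝ) * L (k + j) ≤
      ∑ j ∈ range m, (1 / ((u (k + j) : ℝ) + 1) - 1 / (a (k + j) : ℝ)) := by
    apply sum_le_sum
    intro j _
    have h1 := haR (k + j)
    have h2 := huR (k + j)
    have h3 : L (k + j) ≤ a (k + j) / (u (k + j) + 1) - 1 :=
      Real.log_le_sub_one_of_pos (by positivity)
    calc _ ≤ 1 / (a (k + j) : ℝ) * (a (k + j) / (u (k + j) + 1) - 1) := by gcongr
      _ = _ := by field_simp
  rw [sum_sub_distrib] at hterm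
  have h5 : ∑ i ∈ range k, 1 / (a i : ℝ) ≤ 1 - 1 / (u k : ℝ) := by
    apply ih k hkn
    rw [hsplit] at hlt
    have : 0 ≤ ∑ j ∈ range m, 1 / (a (k + j) : ℝ) := sum_nonneg fun j _ => by positivity
    linarith
  rw [← u_sum] at h5
  rw [← u_sum, hsplit, hsplit (fun i => 1 / (a i : ℝ))] at hcon
  linarith

lemma pow_aux (e : ℕ) : (e + 1) ^ 4 ≤ 625 * 2 ^ e := by
  rcases le_or_gt e 5 with h | h
  · interval_cases e <;> norm_num
  · induction e, h using Nat.le_induction with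
    | base => norm_num
    | succ n hn ih =>
      have hn : 6 ≤ n := hn
      rw [pow_succ 2 n]
      have : (n + 1 + 1) ^ 4 ≤ 2 * (n + 1) ^ 4 := by
        obtain ⟨m, rfl⟩ := Nat.exists_eq_add_of_le hn
        ring_nf
        nlinarith [Nat.zero_le (m^2), Nat.zero_le (m^3), Nat.zero_le (m^4)]
      omega

lemma tau_bound (n : ℕ) (hn : n ≠ 0) : n.divisors.card ^ 4 ≤ 625 ^ 16 * n := by
  rw [Nat.card_divisors hn, ← prod_pow]
  have h1 : ∏ p ∈ n.primeFactors, (n.factorization p + 1) ^ 4 ≤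
      ∏ p ∈ n.primeFactors, ((if p < 16 then 625 else 1) * p ^ n.factorization p) := by
    apply prod_le_prod'
    intro p hp
    have hp2 := (Nat.prime_of_mem_primeFactors hp).two_le
    split_ifs with h
    · exact (pow_aux _).trans (Nat.mul_le_mul_left _ (Nat.pow_le_pow_left hp2 _))
    · have h2 : n.factorization p + 1 ≤ 2 ^ n.factorization p := Nat.lt_two_pow_self
      calc _ ≤ (2 ^ n.factorization p) ^ 4 := Nat.pow_le_pow_left h2 4
        _ = 16 ^ n.factorization p := by rw [← pow_mul, mul_comm, pow_mul]; norm_num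
        _ ≤ p ^ n.factorization p := Nat.pow_le_pow_left (by omega) _
        _ = _ := by simp
  refine h1.trans ?_
  rw [prod_mul_distrib]
  have h3 : ∏ p ∈ n.primeFactors, p ^ n.factorization p = n :=
    Nat.prod_factorization_pow_eq_self hn
  rw [h3]
  apply Nat.mul_le_mul_right
  rw [← prod_filter]
  rw [prod_const]
  apply Nat.pow_le_pow_right (by norm_num)
  calc _ ≤ (range 16).card := card_le_card (by
        intro p hp; simp only [mem_filter, mem_range] at hp ⊢; exact hp.2)
    _ = 16 := by simp

lemma entry_bound (b : ℕ → ℕ) (hb : ∀ i, 0 < b i) (hm : Monotone b) (k : ℕ)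
    (heq : (1 : ℝ) = ∑ i ∈ range k, 1 / (b i : ℝ) + 1 / ∏ i ∈ range k, (b i : ℝ))
    (i : ℕ) (hi : i < k) : b i ≤ (k + 1) * u i := by
  have hbR : ∀ i, (0 : ℝ) < b i := fun i => by exact_mod_cast hb i
  have huR : (0 : ℝ) < u i := by exact_mod_cast u_pos i
  obtain ⟨t, rfl⟩ : ∃ t, k = i + t := ⟨k - i, by omega⟩
  have hPpos : 0 < ∏ j ∈ range (i + t), (b j : ℝ) := prod_pos fun j _ => hbR j
  have hPge : (b i : ℝ) ≤ ∏ j ∈ range (i + t), (b j : ℝ) := by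
    have h1 : b i ∣ ∏ j ∈ range (i + t), b j := dvd_prod_of_mem b (mem_range.mpr hi)
    have h2 := Nat.le_of_dvd (prod_pos fun j _ => hb j) h1
    exact_mod_cast h2
  have hP1 : 1 / ∏ j ∈ range (i + t), (b j : ℝ) ≤ 1 / (b i : ℝ) :=
    one_div_le_one_div_of_le (hbR i) hPge
  have hP2 : 0 < 1 / ∏ j ∈ range (i + t), (b j : ℝ) := by positivity
  rw [sum_range_add] at heq
  have htail0 : 0 ≤ ∑ j ∈ range t, 1 / (b (i + j) : ℝ) := sum_nonneg fun j _ => by positivity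
  have htail : ∑ j ∈ range t, 1 / (b (i + j) : ℝ) ≤ t * (1 / (b i : ℝ)) := by
    have := sum_le_card_nsmul (range t) (fun j => 1 / (b (i + j) : ℝ)) (1 / (b i : ℝ))
      (fun j _ => one_div_le_one_div_of_le (hbR i) (by exact_mod_cast hm (by omega)))
    simpa using this
  have hc := curtiss b hb hm i (by linarith)
  have h1 : 1 / (u i : ℝ) ≤ (t + 1) * (1 / (b i : ℝ)) := by linarith
  have h2 : (b i : ℝ) ≤ (t + 1) * u i := by
    rw [mul_one_div, div_le_div_iff₀ huR (hbR i)] at h1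
    linarith
  have h3 : b i ≤ (t + 1) * u i := by exact_mod_cast h2
  exact h3.trans (Nat.mul_le_mul_right _ (by omega))

def PP {m : ℕ} (p : Fin m → ℕ) : ℕ := ∏ i, p i

def QQ {m : ℕ} (p : Fin m → ℕ) : ℕ := PP p - ∑ i, PP p / p i

lemma key_eq {m : ℕ} (p : Fin m → ℕ) (hp : ∀ i, 0 < p i) (x y : ℕ) (hx : 0 < x) (hy : 0 < y)
    (h : (1 : ℚ) = (∑ i, (1 : ℚ) / p i + 1 / x + 1 / y) + 1 / ((∏ i, (p i : ℚ)) * x * y)) :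
    QQ p * x * y = PP p * (x + y) + 1 := by
  have hpQ : ∀ i, (0 : ℚ) < p i := fun i => by exact_mod_cast hp i
  have hxQ : (0 : ℚ) < x := by exact_mod_cast hx
  have hyQ : (0 : ℚ) < y := by exact_mod_cast hy
  have hP : (0 : ℚ) < PP p := by
    have : 0 < PP p := prod_pos fun j _ => hp j
    exact_mod_cast this
  have hPc : ∏ i, (p i : ℚ) = PP p := by simp [PP]
  rw [hPc] at h
  have hS : ((∑ i, PP p / p i : ℕ) : ℚ) = PP p * ∑ i, (1 : ℚ) / p i := by
    push_cast
    rw [mul_sum]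
    apply sum_congr rfl
    intro i _
    have hd : p i ∣ PP p := dvd_prod_of_mem p (mem_univ i)
    rw [Nat.cast_div hd (hpQ i).ne', mul_one_div]
  have hpos : 0 ≤ (1 : ℚ) / x + 1 / y + 1 / (PP p * x * y) := by positivity
  have hle : ∑ i, PP p / p i ≤ PP p := by
    have : ((∑ i, PP p / p i : ℕ) : ℚ) ≤ PP p := by
      rw [hS]
      have : ∑ i, (1 : ℚ) / p i ≤ 1 := by linarith
      nlinarith
    exact_mod_cast this
  have hQ : (QQ p : ℚ) = PP p * (1 - ∑ i, (1 : ℚ) / p i) := by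
    rw [QQ, Nat.cast_sub hle, hS]; ring
  have h1 : 1 - ∑ i, (1 : ℚ) / p i = (1 : ℚ) / x + 1 / y + 1 / (PP p * x * y) := by linarith
  rw [h1] at hQ
  have : (QQ p * x * y : ℚ) = PP p * (x + y) + 1 := by
    rw [hQ]; field_simp; ring
  exact_mod_cast this

abbrev Sol (k : ℕ) := {a : Fin k → ℕ // (∀ i, 0 < a i) ∧ Monotone a ∧
    (1 : ℚ) = (∑ i, (1 : ℚ) / a i) + 1 / (∏ i, (a i : ℚ))}

lemma sol_bound {m : ℕ} (a : Sol (m + 2)) (i : Fin (m + 2)) : a.1 i ≤ (m + 3) * u i := by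
  obtain ⟨a, hpos, hmono, heq⟩ := a
  have := entry_bound (fun j => a ⟨min j (m + 1), by omega⟩) (fun j => hpos _)
    (fun i j hij => hmono (by simp only [Fin.mk_le_mk]; omega)) (m + 2)
    (by
      have h := congrArg (fun q : ℚ => (q : ℝ)) heq
      push_cast at h
      rw [← Fin.sum_univ_eq_sum_range (fun j => 1 / ((a ⟨min j (m + 1), by omega⟩ : ℕ) : ℝ)),
        ← Fin.prod_univ_eq_prod_range (fun j => ((a ⟨min j (m + 1), by omega⟩ : ℕ) : ℝ))]
      have hh : ∀ i : Fin (m + 2), (⟨min (i : ℕ) (m + 1), by omega⟩ : Fin (m + 2)) = i := by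
        intro i; ext; simp; omega
      simp only [hh]
      exact h) i i.2
  have hh : (⟨min (i : ℕ) (m + 1), by omega⟩ : Fin (m + 2)) = i := by ext; simp; omega
  simpa only [hh] using this

def pre {m : ℕ} (a : Fin (m + 2) → ℕ) : Fin m → ℕ := fun i => a i.castSucc.castSucc
def xx {m : ℕ} (a : Fin (m + 2) → ℕ) : ℕ := a (Fin.last m).castSucc
def yy {m : ℕ} (a : Fin (m + 2) → ℕ) : ℕ := a (Fin.last (m + 1))

lemma sol_key {m : ℕ} (a : Sol (m + 2)) :
    QQ (pre a.1) * xx a.1 * yy a.1 = PP (pre a.1) * (xx a.1 + yy a.1) + 1 := by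
  obtain ⟨a, hpos, hmono, heq⟩ := a
  apply key_eq _ (fun i => hpos _) _ _ (hpos _) (hpos _)
  rw [Fin.sum_univ_castSucc, Fin.sum_univ_castSucc, Fin.prod_univ_castSucc,
    Fin.prod_univ_castSucc] at heq
  exact heq

lemma sol_lt {m : ℕ} (a : Sol (m + 2)) : PP (pre a.1) < QQ (pre a.1) * xx a.1 := by
  have h := sol_key a
  have hy : 0 < yy a.1 := a.2.1 _
  by_contra! hc
  have := Nat.mul_le_mul_right (yy a.1) hc
  nlinarith [Nat.zero_le (PP (pre a.1) * xx a.1)]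

lemma sol_dvd {m : ℕ} (a : Sol (m + 2)) :
    QQ (pre a.1) * xx a.1 - PP (pre a.1) ∣ PP (pre a.1) ^ 2 + QQ (pre a.1) := by
  have h := sol_key a
  have hl := sol_lt a
  zify [hl.le] at h hl ⊢
  refine ⟨QQ (pre a.1) * yy a.1 - PP (pre a.1), ?_⟩
  linear_combination (-(QQ (pre a.1) : ℤ)) * h

lemma sol_inj {m : ℕ} (a b : Sol (m + 2)) (hp : pre a.1 = pre b.1)
    (hd : QQ (pre a.1) * xx a.1 - PP (pre a.1) = QQ (pre b.1) * xx b.1 - PP (pre b.1)) :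
    a = b := by
  have ha := sol_key a
  have hb := sol_key b
  have hla := sol_lt a
  have hlb := sol_lt b
  rw [← hp] at hd hb hlb
  have hQ : 0 < QQ (pre a.1) := by
    rcases Nat.eq_zero_or_pos (QQ (pre a.1)) with h | h
    · simp [h] at hla
    · exact h
  have hx : xx a.1 = xx b.1 := by
    apply Nat.eq_of_mul_eq_mul_left hQ
    omega
  rw [← hx] at hb hlb
  have hy : yy a.1 = yy b.1 := by
    zify at ha hb hla ⊢
    have h1 : ((QQ (pre a.1) : ℤ) * xx a.1 - PP (pre a.1)) * (yy a.1 - yy b.1) = 0 := by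
      linear_combination ha - hb
    rcases mul_eq_zero.mp h1 with h | h <;> linarith
  apply Subtype.ext
  funext i
  induction i using Fin.lastCases with
  | last => exact hy
  | cast i =>
    induction i using Fin.lastCases with
    | last => exact hx
    | cast i => exact congrFun hp i

def BB (m : ℕ) : ℕ := ∏ i : Fin m, ((m + 3) * u i)

lemma S_bound (m : ℕ) : ∃ t : ℕ, t ^ 4 ≤ 625 ^ 16 * (2 * BB m ^ 2) ∧ S (m + 2) ≤ BB m * t := by
  classical
  set box : Finset (Fin m → ℕ) := Fintype.piFinset (fun i : Fin m => Finset.Icc 1 ((m + 3) * u i))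
    with hbox
  have hcard : box.card = BB m := by
    simp [hbox, Fintype.card_piFinset, BB]
  set T : Finset (Σ _ : Fin m → ℕ, ℕ) := box.sigma (fun p => (PP p ^ 2 + QQ p).divisors) with hT
  have hpre : ∀ a : Sol (m + 2), pre a.1 ∈ box := by
    intro a
    rw [hbox, Fintype.mem_piFinset]
    intro i
    rw [Finset.mem_Icc]
    exact ⟨a.2.1 _, sol_bound a _⟩
  have hmem : ∀ a : Sol (m + 2),
      (⟨pre a.1, QQ (pre a.1) * xx a.1 - PP (pre a.1)⟩ : Σ _ : Fin m → ℕ, ℕ) ∈ T := by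
    intro a
    rw [hT, mem_sigma]
    refine ⟨hpre a, ?_⟩
    rw [Nat.mem_divisors]
    refine ⟨sol_dvd a, ?_⟩
    have : 0 < PP (pre a.1) := prod_pos fun j _ => a.2.1 _
    positivity
  have hS : S (m + 2) ≤ T.card := by
    have h := Nat.card_le_card_of_injective
      (fun a : Sol (m + 2) => (⟨_, hmem a⟩ : T)) (by
        intro a b hab
        simp only [Subtype.mk.injEq, Sigma.mk.injEq, heq_eq_eq] at hab
        exact sol_inj a b hab.1 hab.2)
    have h2 : Nat.card T = T.card := by simp
    rw [h2] at h
    exact h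
  obtain ⟨p₀, hp₀, hmax⟩ : ∃ p₀ ∈ box, ∀ p ∈ box,
      (PP p ^ 2 + QQ p).divisors.card ≤ (PP p₀ ^ 2 + QQ p₀).divisors.card := by
    apply Finset.exists_max_image
    rw [← Finset.card_pos, hcard]
    exact prod_pos fun i _ => Nat.mul_pos (by omega) (u_pos _)
  refine ⟨(PP p₀ ^ 2 + QQ p₀).divisors.card, ?_, ?_⟩
  · rw [hbox, Fintype.mem_piFinset] at hp₀
    simp only [Finset.mem_Icc] at hp₀
    have hpos : 0 < PP p₀ := prod_pos fun j _ => (hp₀ j).1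
    refine (tau_bound _ (by positivity)).trans (Nat.mul_le_mul_left _ ?_)
    have h1 : PP p₀ ≤ BB m := prod_le_prod' fun j _ => (hp₀ j).2
    have h2 : QQ p₀ ≤ PP p₀ := Nat.sub_le _ _
    nlinarith
  · refine hS.trans ?_
    rw [hT, card_sigma, ← hcard, ← smul_eq_mul]
    exact sum_le_card_nsmul _ _ _ hmax

lemma u_sq (n : ℕ) : u n ^ 2 ≤ u (n + 1) := by
  simp only [u]; nlinarith

lemma BB_le (m : ℕ) : BB m ≤ (m + 3) ^ m * u m := by
  rw [BB, prod_mul_distrib]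
  simp only [prod_const, card_univ, Fintype.card_fin]
  apply Nat.mul_le_mul_left
  rw [Fin.prod_univ_eq_prod_range (fun i => u i)]
  induction m with
  | zero => simp [u]
  | succ n ih =>
    rw [prod_range_succ]
    exact (Nat.mul_le_mul_right _ ih).trans (by have := u_sq n; nlinarith)

lemma S_pow (m : ℕ) : S (m + 2) ^ 4 ≤ 625 ^ 16 * 2 * ((m + 3) ^ m * u m) ^ 6 := by
  obtain ⟨t, ht, hS⟩ := S_bound m
  calc S (m + 2) ^ 4 ≤ (BB m * t) ^ 4 := Nat.pow_le_pow_left hS 4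
    _ = BB m ^ 4 * t ^ 4 := mul_pow _ _ _
    _ ≤ BB m ^ 4 * (625 ^ 16 * (2 * BB m ^ 2)) := Nat.mul_le_mul_left _ ht
    _ = 625 ^ 16 * 2 * BB m ^ 6 := by ring
    _ ≤ _ := Nat.mul_le_mul_left _ (Nat.pow_le_pow_left (BB_le m) 6)

lemma root_mono : Monotone (fun n : ℕ => (u n : ℝ) ^ ((1 : ℝ) / 2 ^ n)) := by
  apply monotone_nat_of_le_succ
  intro n
  have h : ((u n : ℝ)) ^ 2 ≤ u (n + 1) := by exact_mod_cast u_sq n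
  calc (u n : ℝ) ^ ((1 : ℝ) / 2 ^ n) = ((u n : ℝ) ^ 2) ^ ((1 : ℝ) / 2 ^ (n + 1)) := by
        rw [← Real.rpow_natCast (u n : ℝ) 2, ← Real.rpow_mul (by positivity)]
        congr 1
        rw [pow_succ]; field_simp; norm_num
    _ ≤ _ := Real.rpow_le_rpow (by positivity) h (by positivity)

theorem stmt_6 (c₀ : ℝ)
    (hc₀ : Filter.Tendsto (fun n : ℕ => (u n : ℝ) ^ ((1 : ℝ) / 2 ^ n))
      Filter.atTop (nhds c₀)) :
    ∀ ε : ℝ, 0 < ε → ∃ K : ℕ, ∀ k : ℕ, K ≤ k → 1 ≤ k →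
      (S k : ℝ) ≤ c₀ ^ ((7 / 17 + ε) * 2 ^ k) := by
  intro ε hε
  have hge : ∀ n, (u n : ℝ) ^ ((1 : ℝ) / 2 ^ n) ≤ c₀ := fun n => root_mono.ge_of_tendsto hc₀ n
  have hc1 : 1 < c₀ := by
    refine lt_of_lt_of_le ?_ (hge 1)
    apply Real.one_lt_rpow
    · simp [u]
    · norm_num
  have hc0 : 0 < c₀ := by linarith
  have hu : ∀ n, (u n : ℝ) ≤ c₀ ^ ((2 : ℝ) ^ n) := by
    intro n
    have := Real.rpow_le_rpow (by positivity) (hge n) (by positivity : (0 : ℝ) ≤ 2 ^ n)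
    rwa [← Real.rpow_mul (by positivity), one_div_mul_cancel (by positivity), Real.rpow_one] at this
  have hlog : 0 < Real.log c₀ := Real.log_pos hc1
  obtain ⟨C, hC1, hSC⟩ : ∃ C : ℝ, 1 < C ∧
      ∀ m : ℕ, (S (m + 2) : ℝ) ^ 4 ≤ C * (((m : ℝ) + 3) ^ m * u m) ^ 6 :=
    ⟨625 ^ 16 * 2, by norm_num, fun m => by exact_mod_cast S_pow m⟩
  have hgrow : ∀ᶠ m : ℕ in Filter.atTop,
      Real.log C + 6 * m * Real.log (m + 3) ≤ (10 / 17) * Real.log c₀ * 2 ^ m := by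
    have h1 : Filter.Tendsto (fun m : ℕ => (m : ℝ) ^ 2 / 2 ^ m) Filter.atTop (nhds 0) :=
      tendsto_pow_const_div_const_pow_of_one_lt 2 (by norm_num)
    set D : ℝ := Real.log C + 24 with hD
    have hD0 : 0 < D := by
      have : 0 < Real.log C := Real.log_pos hC1
      linarith
    have h2 := h1.eventually_lt_const (show 0 < (10 / 17) * Real.log c₀ / D by positivity)
    filter_upwards [h2, Filter.eventually_ge_atTop 1] with m hm hm1
    have hm1' : (1 : ℝ) ≤ m := by exact_mod_cast hm1
    rw [div_lt_div_iff₀ (by positivity) hD0] at hm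
    have h3 : Real.log (m + 3) ≤ 4 * m := by
      have := Real.log_le_sub_one_of_pos (show (0 : ℝ) < m + 3 by positivity)
      linarith
    have h4 : 6 * m * Real.log (m + 3) ≤ 6 * m * (4 * m) := by gcongr
    have h5 : 0 < Real.log C := Real.log_pos hC1
    have h6 : Real.log C ≤ Real.log C * (m : ℝ) ^ 2 := by
      apply le_mul_of_one_le_right h5.le
      exact one_le_pow₀ hm1'
    rw [hD] at hm
    nlinarith
  obtain ⟨K, hK⟩ := Filter.eventually_atTop.mp hgrow
  refine ⟨K + 2, fun k hk _ => ?_⟩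
  obtain ⟨m, rfl⟩ : ∃ m, k = m + 2 := ⟨k - 2, by omega⟩
  have hg := hK m (by omega)
  have hmain : (S (m + 2) : ℝ) ≤ c₀ ^ ((7 / 17 : ℝ) * 2 ^ (m + 2)) := by
    have h1 : (S (m + 2) : ℝ) ^ 4 ≤ C * (((m : ℝ) + 3) ^ m * u m) ^ 6 := hSC m
    have h2 : (C * (((m : ℝ) + 3) ^ m * u m) ^ 6 : ℝ) ≤
        (c₀ ^ ((7 / 17 : ℝ) * 2 ^ (m + 2))) ^ 4 := by
      have hupos : (0 : ℝ) < u m := by exact_mod_cast u_pos m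
      rw [← Real.log_le_log_iff (by positivity) (by positivity)]
      have hlu : Real.log (u m) ≤ 2 ^ m * Real.log c₀ := by
        rw [← Real.log_rpow hc0]
        exact Real.log_le_log hupos (hu m)
      rw [Real.log_mul (by positivity) (by positivity), Real.log_pow, Real.log_pow,
        Real.log_mul (by positivity) (by positivity), Real.log_pow, Real.log_rpow hc0, pow_add]
      push_cast
      nlinarith
    exact le_of_pow_le_pow_left₀ (by norm_num) (by positivity) (h1.trans h2)
  refine hmain.trans ?_
  apply Real.rpow_le_rpow_of_exponent_le hc1.le
  gcongr
  linarith
end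

section
/- For every positive integer m and every ε > 0, the set of positive integers n satisfying f₃(m,n) ≥ (log n)^(log 3 − ε) has natural density one, i.e. the proportion of n ≤ x lying in this set tends to 1 as x → ∞. -/
/-- `numSols k m n` is the number of nondecreasing `k`-tuples of positive integers
`(a₁, …, a_k)` with `m / n = 1/a₁ + ⋯ + 1/a_k`. -/
noncomputable def numSols (k m n : ℕ) : ℕ :=
  Nat.card {a : Fin k → ℕ // (∀ i, 0 < a i) ∧ Monotone a ∧
    (m : ℚ) / n = ∑ i, (1 : ℚ) / a i}

open ArithmeticFunction.vonMangoldt in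
lemma not_summable_inv_class {q : ℕ} [NeZero q] {a : ZMod q} (ha : IsUnit a) :
    ¬ Summable fun n : ℕ => if n.Prime ∧ (n : ZMod q) = a then (1 : ℝ) / n else 0 := by
  intro H
  have hsum := H.add (summable_residueClass_non_primes_div a)
  obtain ⟨C, hC⟩ := LSeries_residueClass_lower_bound ha
  have hlim : Filter.Tendsto (fun x : ℝ => ∑' n : ℕ, (x - 1) * (residueClass a n / (n : ℝ) ^ x))
      (nhdsWithin 1 (Set.Ioi 1)) (nhds (∑' n : ℕ, (0 : ℝ))) := by
    refine tendsto_tsum_of_dominated_convergence hsum ?_ ?_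
    · intro n
      rcases n.eq_zero_or_pos with rfl | hn
      · simp
      have hn' : (0 : ℝ) < n := by exact_mod_cast hn
      have : ContinuousAt (fun x : ℝ => (x - 1) * (residueClass a n / (n : ℝ) ^ x)) 1 := by
        refine ContinuousAt.mul (by fun_prop) (ContinuousAt.div (by fun_prop) ?_ (by positivity))
        exact (Real.continuousAt_const_rpow hn'.ne')
      have h2 := this.tendsto
      simp only [sub_self, zero_mul] at h2
      exact h2.mono_left nhdsWithin_le_nhds
    · have : Set.Ioc (1 : ℝ) 2 ∈ nhdsWithin (1 : ℝ) (Set.Ioi 1) :=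
        Ioc_mem_nhdsGT (by norm_num)
      filter_upwards [this] with x hx n
      rcases n.eq_zero_or_pos with rfl | hn
      · simp
      have hn' : (1 : ℝ) ≤ n := by exact_mod_cast hn
      have h0 : (0 : ℝ) < n := by linarith
      have hx1 : 0 < x - 1 := by linarith [hx.1]
      have hr := residueClass_nonneg a n
      rw [Real.norm_of_nonneg (by positivity)]
      have hpow : (n : ℝ) ^ x = n ^ (x - 1) * n := by
        rw [← Real.rpow_add_one h0.ne']; congr 1; ring
      have hpow1 : (1 : ℝ) ≤ (n : ℝ) ^ (x - 1) := Real.one_le_rpow hn' hx1.le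
      have hpp : (0 : ℝ) < (n : ℝ) ^ (x - 1) := by linarith
      by_cases hp : n.Prime
      · by_cases hc : (n : ZMod q) = a
        · have hval : residueClass a n = Real.log n := by
            simp [residueClass, hc, ArithmeticFunction.vonMangoldt_apply_prime hp]
          simp only [hp, hc, and_self, if_true, zero_div, add_zero]
          rw [hval, hpow, mul_div_assoc', div_le_div_iff₀ (by positivity) h0]
          have := Real.log_le_sub_one_of_pos hpp
          rw [Real.log_rpow h0] at this
          nlinarith
        · have hval : residueClass a n = 0 := by
            simp [residueClass, hc]
          simp [hc, hp]
      · simp only [hp, false_and, if_false, zero_add]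
        rw [hpow, mul_div_assoc', div_le_div_iff₀ (by positivity) h0]
        have h1 : x - 1 ≤ (n : ℝ) ^ (x - 1) := by linarith [hx.2]
        have := mul_le_mul_of_nonneg_right h1 (mul_nonneg hr h0.le)
        nlinarith
  rw [tsum_zero] at hlim
  have hq : 0 < (q.totient : ℝ)⁻¹ := inv_pos.mpr (mod_cast q.totient.pos_of_neZero)
  have hlow : Filter.Tendsto (fun x : ℝ => (q.totient : ℝ)⁻¹ - C * (x - 1))
      (nhdsWithin 1 (Set.Ioi 1)) (nhds ((q.totient : ℝ)⁻¹)) := by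
    have : Continuous (fun x : ℝ => (q.totient : ℝ)⁻¹ - C * (x - 1)) := by fun_prop
    have h2 := this.tendsto 1
    simp only [sub_self, mul_zero, sub_zero] at h2
    exact h2.mono_left nhdsWithin_le_nhds
  have := le_of_tendsto_of_tendsto hlow hlim (by
    have : Set.Ioc (1 : ℝ) 2 ∈ nhdsWithin (1 : ℝ) (Set.Ioi 1) :=
        Ioc_mem_nhdsGT (by norm_num)
    filter_upwards [this] with x hx
    have hx1 : 0 < x - 1 := by linarith [hx.1]
    rw [tsum_mul_left]
    have h3 := mul_le_mul_of_nonneg_left (hC hx) hx1.le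
    refine le_trans (le_of_eq ?_) h3
    field_simp)
  linarith

open Finset in
lemma turan_var (N : ℕ) (P : Finset ℕ) (hP : ∀ p ∈ P, p.Prime ∧ p ≤ N) :
    ∑ n ∈ Ioc 0 N, ((#{p ∈ P | p ∣ n} : ℝ) - ∑ p ∈ P, (1 : ℝ) / p) ^ 2
      ≤ 3 * N * ∑ p ∈ P, (1 : ℝ) / p := by
  set A := ∑ p ∈ P, (1 : ℝ) / p with hA
  have hA0 : 0 ≤ A := Finset.sum_nonneg fun p _ => by positivity
  have hcount : ∀ d : ℕ, ∑ n ∈ Ioc 0 N, (if d ∣ n then (1 : ℝ) else 0) = ((N / d : ℕ) : ℝ) := by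
    intro d
    rw [Finset.sum_boole, Nat.Ioc_filter_dvd_card_eq_div]
  have hc : ∀ n, (#{p ∈ P | p ∣ n} : ℝ) = ∑ p ∈ P, if p ∣ n then (1 : ℝ) else 0 := by
    intro n; rw [Finset.sum_boole]
  have hPN : (#P : ℝ) ≤ N := by
    have : P ⊆ Ioc 0 N := fun p hp => by
      simp only [mem_Ioc]; exact ⟨(hP p hp).1.pos, (hP p hp).2⟩
    have := card_le_card this
    simp only [Nat.card_Ioc, tsub_zero] at this
    exact_mod_cast this
  have h1 : N * A - N ≤ ∑ n ∈ Ioc 0 N, (#{p ∈ P | p ∣ n} : ℝ) := by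
    simp_rw [hc]
    rw [sum_comm]
    simp_rw [hcount]
    calc N * A - N ≤ N * A - #P := by linarith
      _ = ∑ p ∈ P, ((N : ℝ) / p - 1) := by
        rw [sum_sub_distrib, hA, mul_sum]; simp [div_eq_mul_inv]
      _ ≤ _ := by
        refine sum_le_sum fun p hp => ?_
        have hp0 : (0 : ℝ) < p := by exact_mod_cast (hP p hp).1.pos
        rw [sub_le_iff_le_add, div_le_iff₀ hp0]
        have := Nat.lt_div_mul_add (a := N) (hP p hp).1.pos
        have h : N ≤ (N / p + 1) * p := by nlinarith
        exact_mod_cast h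
  have h2 : ∑ n ∈ Ioc 0 N, (#{p ∈ P | p ∣ n} : ℝ) ^ 2 ≤ N * A ^ 2 + N * A := by
    simp_rw [hc, pow_two, sum_mul_sum]
    rw [sum_comm]
    have : ∀ p ∈ P, ∑ n ∈ Ioc 0 N, ∑ r ∈ P, ((if p ∣ n then (1 : ℝ) else 0) * if r ∣ n then (1 : ℝ) else 0)
        ≤ N * A * (1 / p) + N * (1 / p) := by
      intro p hp
      have hp0 : (0 : ℝ) < p := by exact_mod_cast (hP p hp).1.pos
      rw [sum_comm]
      calc _ ≤ ∑ r ∈ P, ((N : ℝ) * (1 / r) * (1 / p) + if p = r then (N : ℝ) * (1 / p) else 0) := by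
            refine sum_le_sum fun r hr => ?_
            have hr0 : (0 : ℝ) < r := by exact_mod_cast (hP r hr).1.pos
            by_cases hpr : p = r
            · subst hpr
              simp only [mul_ite, mul_one, mul_zero, if_true]
              have : ∀ n : ℕ, (if p ∣ n then (if p ∣ n then (1 : ℝ) else 0) else 0) = if p ∣ n then 1 else 0 := by
                intro n; split_ifs <;> rfl
              simp_rw [this, hcount]
              have h3 := Nat.cast_div_le (α := ℝ) (m := N) (n := p)
              have h4 : (0 : ℝ) ≤ N * (1 / p) * (1 / p) := by positivity
              rw [div_eq_mul_one_div] at h3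
              linarith
            · have : ∀ n : ℕ, ((if p ∣ n then (1 : ℝ) else 0) * if r ∣ n then (1 : ℝ) else 0) = if p * r ∣ n then 1 else 0 := by
                intro n
                have hco : Nat.Coprime p r := (Nat.coprime_primes (hP p hp).1 (hP r hr).1).2 hpr
                have : p * r ∣ n ↔ p ∣ n ∧ r ∣ n :=
                  ⟨fun h => ⟨(dvd_mul_right _ _).trans h, (dvd_mul_left _ _).trans h⟩,
                   fun h => hco.mul_dvd_of_dvd_of_dvd h.1 h.2⟩
                simp only [this]
                split_ifs <;> simp_all
              simp_rw [this, hcount]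
              have h3 := Nat.cast_div_le (α := ℝ) (m := N) (n := p * r)
              simp only [hpr, if_false, add_zero]
              refine h3.trans (le_of_eq ?_)
              push_cast; field_simp
        _ = _ := by
            rw [sum_add_distrib, sum_ite_eq, if_pos hp, ← sum_mul, ← mul_sum]
    refine (sum_le_sum this).trans (le_of_eq ?_)
    rw [sum_add_distrib, ← mul_sum, ← mul_sum]; ring
  have hexp : ∑ n ∈ Ioc 0 N, ((#{p ∈ P | p ∣ n} : ℝ) - A) ^ 2 =
      ∑ n ∈ Ioc 0 N, (#{p ∈ P | p ∣ n} : ℝ) ^ 2 - 2 * A * ∑ n ∈ Ioc 0 N, (#{p ∈ P | p ∣ n} : ℝ)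
        + N * A ^ 2 := by
    rw [mul_sum, ← sum_sub_distrib]
    have : (N : ℝ) * A ^ 2 = ∑ n ∈ Ioc 0 N, A ^ 2 := by simp
    rw [this, ← sum_add_distrib]
    exact sum_congr rfl fun n _ => by ring
  rw [hexp]
  nlinarith [mul_le_mul_of_nonneg_left h1 hA0]

open Finset in
lemma turan_cheb (N : ℕ) (P : Finset ℕ) (hP : ∀ p ∈ P, p.Prime ∧ p ≤ N) (δ : ℝ) (hδ : 0 < δ)
    (hA : 0 < ∑ p ∈ P, (1 : ℝ) / p) :
    (#{n ∈ Ioc 0 N | (#{p ∈ P | p ∣ n} : ℝ) ≤ (1 - δ) * ∑ p ∈ P, (1 : ℝ) / p} : ℝ)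
      ≤ N * (3 / δ ^ 2 * (∑ p ∈ P, (1 : ℝ) / p)⁻¹) := by
  have h := turan_var N P hP
  set A := ∑ p ∈ P, (1 : ℝ) / p with hA'
  have h1 : (#{n ∈ Ioc 0 N | (#{p ∈ P | p ∣ n} : ℝ) ≤ (1 - δ) * A} : ℝ) * (δ * A) ^ 2 ≤ 3 * N * A := by
    refine le_trans ?_ h
    rw [← nsmul_eq_mul]
    refine (Finset.card_nsmul_le_sum _ (fun n => ((#{p ∈ P | p ∣ n} : ℝ) - A) ^ 2) _ ?_).trans
      (sum_le_sum_of_subset_of_nonneg (filter_subset _ _) fun _ _ _ => by positivity)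
    intro n hn
    have := (mem_filter.1 hn).2
    have : 0 < δ * A := by positivity
    nlinarith
  have : (N : ℝ) * (3 / δ ^ 2 * A⁻¹) = (3 * N * A) / (δ * A) ^ 2 := by field_simp
  rw [this, le_div_iff₀ (by positivity)]
  exact h1

open Finset in
lemma mertens_lower (N : ℕ) (hN : 3 ≤ N) :
    Real.log (Real.log N) - 1 ≤ ∑ p ∈ (Ioc 0 N).filter Nat.Prime, (1 : ℝ) / p := by
  let f : ℕ →* ℝ := ⟨⟨fun n => (n : ℝ)⁻¹, by simp⟩, by intro a b; simp [mul_comm]⟩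
  have hf : ∀ n, f n = (n : ℝ)⁻¹ := fun n => rfl
  have H := EulerProduct.summable_and_hasSum_smoothNumbers_prod_primesBelow_geometric (f := f)
    (by intro p hp
        rw [hf, Real.norm_of_nonneg (by positivity)]
        exact inv_lt_one_of_one_lt₀ (by exact_mod_cast hp.one_lt)) (N + 1)
  have hset : (N + 1).primesBelow = (Ioc 0 N).filter Nat.Prime := by
    ext p
    simp only [Nat.mem_primesBelow, mem_filter, mem_Ioc]
    exact ⟨fun h => ⟨⟨h.2.pos, by omega⟩, h.2⟩, fun h => ⟨by omega, h.2⟩⟩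
  rw [hset] at H
  have hlogN : 0 < Real.log N := Real.log_pos (by exact_mod_cast (by omega : 1 < N))
  have h1 : Real.log N ≤ ∏ p ∈ (Ioc 0 N).filter Nat.Prime, (1 - f p)⁻¹ := by
    have hmem : ∀ n ∈ Icc 1 N, n ∈ (N + 1).smoothNumbers := by
      intro n hn
      rw [mem_Icc] at hn
      exact Nat.mem_smoothNumbers_of_lt (by omega) (by omega)
    have h2 : ∑ n ∈ Icc 1 N, (n : ℝ)⁻¹ ≤ ∏ p ∈ (Ioc 0 N).filter Nat.Prime, (1 - f p)⁻¹ := by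
      have := sum_le_hasSum ((Icc 1 N).attach.map
        ⟨fun n => (⟨n.1, hmem n.1 n.2⟩ : (N + 1).smoothNumbers), fun a b hab =>
          Subtype.ext (Subtype.mk.inj hab)⟩) (fun i _ => by rw [hf]; positivity) H.2
      rw [sum_map] at this
      rw [← sum_attach (Icc 1 N) (fun n => (n : ℝ)⁻¹)]
      exact this
    refine le_trans ?_ h2
    have := log_add_one_le_harmonic N
    rw [harmonic_eq_sum_Icc] at this
    push_cast at this
    refine le_trans (Real.log_le_log (by positivity) ?_) this
    push_cast; linarith
  have h3 := Real.log_le_log hlogN h1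
  have hpos : ∀ p ∈ (Ioc 0 N).filter Nat.Prime, (2 : ℝ) ≤ p := by
    intro p hp
    exact_mod_cast (mem_filter.1 hp).2.two_le
  rw [Real.log_prod (by
    intro p hp
    have := hpos p hp
    have : (p : ℝ)⁻¹ < 1 := inv_lt_one_of_one_lt₀ (by linarith)
    rw [hf]; exact inv_ne_zero (by linarith))] at h3
  have h4 : ∀ p ∈ (Ioc 0 N).filter Nat.Prime, Real.log ((1 - f p)⁻¹) ≤ 1 / p + (1 / ((p : ℝ) - 1) - 1 / p) := by
    intro p hp
    have := hpos p hp
    have h5 : (p : ℝ)⁻¹ < 1 := inv_lt_one_of_one_lt₀ (by linarith)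
    refine (Real.log_le_sub_one_of_pos (inv_pos.2 (by rw [hf]; linarith))).trans (le_of_eq ?_)
    rw [hf]
    have h6 : (p : ℝ) - 1 ≠ 0 := by linarith
    have h7 : (1 : ℝ) - (p : ℝ)⁻¹ = (p - 1) / p := by field_simp
    rw [h7]
    field_simp
    ring
  have h5 : ∑ p ∈ (Ioc 0 N).filter Nat.Prime, (1 / ((p : ℝ) - 1) - 1 / p) ≤ 1 := by
    have htel : ∀ M : ℕ, 1 ≤ M → ∑ p ∈ Ioc 1 M, (1 / ((p : ℝ) - 1) - 1 / p) = 1 - 1 / M := by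
      intro M hM
      induction M, hM using Nat.le_induction with
      | base => simp
      | succ k hk ih =>
        rw [← Finset.insert_Ioc_right_eq_Ioc_add_one (by omega), sum_insert (by simp), ih]
        push_cast
        simp
    refine (sum_le_sum_of_subset_of_nonneg (t := Ioc 1 N) ?_ ?_).trans ?_
    · intro p hp
      rw [mem_filter, mem_Ioc] at hp
      rw [mem_Ioc]
      exact ⟨hp.2.one_lt, hp.1.2⟩
    · intro p hp _
      rw [mem_Ioc] at hp
      have : (2 : ℝ) ≤ p := by exact_mod_cast hp.1
      rw [sub_nonneg]
      exact one_div_le_one_div_of_le (by linarith) (by linarith)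
    · rw [htel N (by omega)]
      have : (0 : ℝ) ≤ 1 / N := by positivity
      linarith
  have h6 := sum_le_sum h4
  rw [sum_add_distrib] at h6
  linarith

lemma sols_bound (m n x y z : ℕ) (hn : 0 < n) (hm : 0 < m) (hx : 0 < x) (hy : 0 < y) (hz : 0 < z)
    (hxy : x ≤ y) (hyz : y ≤ z) (key : m * (x * y * z) = n * (y * z + x * z + x * y)) :
    x ≤ 3 * n ∧ y ≤ 2 * n * x ∧ z ≤ n * x * y := by
  refine ⟨?_, ?_, ?_⟩
  · have h1 : x * (y * z) ≤ (3 * n) * (y * z) := by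
      have e1 : x * z ≤ y * z := Nat.mul_le_mul_right z hxy
      have e2 : x * y ≤ y * z := by nlinarith
      calc x * (y * z) ≤ m * (x * (y * z)) := Nat.le_mul_of_pos_left _ hm
        _ = n * (y * z + x * z + x * y) := by rw [← key]; ring
        _ ≤ n * (y * z + y * z + y * z) := by gcongr
        _ = _ := by ring
    exact Nat.le_of_mul_le_mul_right h1 (by positivity)
  · zify at *
    have e1 : ((m : ℤ) * x - n) * (y * z) = n * x * (y + z) := by linear_combination key
    have e2 : 0 < (m : ℤ) * x - n := by
      by_contra hneg
      push Not at hneg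
      have : 0 < (n : ℤ) * x * (y + z) := by positivity
      have h3 : 0 < (y : ℤ) * z := by positivity
      nlinarith
    have e3 : (y : ℤ) * z ≤ (2 * n * x) * z := by
      have h3 : 0 < (y : ℤ) * z := by positivity
      have h4 : (n : ℤ) * x * (y + z) ≤ n * x * (z + z) := by gcongr
      nlinarith
    exact le_of_mul_le_mul_right e3 hz
  · zify at *
    have e1 : ((m : ℤ) * x * y - n * y - n * x) * z = n * x * y := by linear_combination key
    have e2 : 0 < (m : ℤ) * x * y - n * y - n * x := by
      by_contra hneg
      push Not at hneg
      have : 0 < (n : ℤ) * x * y := by positivity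
      nlinarith
    nlinarith

lemma sols_finite (m n : ℕ) (hn : 0 < n) (hm : 0 < m) :
    Finite {a : Fin 3 → ℕ // (∀ i, 0 < a i) ∧ Monotone a ∧
    (m : ℚ) / n = ∑ i, (1 : ℚ) / a i} := by
  refine Set.Finite.subset (Set.finite_Iic (fun _ : Fin 3 => n * (3 * n) * (2 * n * (3 * n)))) ?_
  rintro a ⟨h0, hmono, hs⟩
  have ha := h0 0
  have hb := h0 1
  have hc := h0 2
  have hab : a 0 ≤ a 1 := hmono (by decide)
  have hbc : a 1 ≤ a 2 := hmono (by decide)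
  rw [Fin.sum_univ_three] at hs
  have hn' : (n : ℚ) ≠ 0 := by positivity
  have ha' : (a 0 : ℚ) ≠ 0 := by positivity
  have hb' : (a 1 : ℚ) ≠ 0 := by positivity
  have hc' : (a 2 : ℚ) ≠ 0 := by positivity
  have key : m * (a 0 * a 1 * a 2) = n * (a 1 * a 2 + a 0 * a 2 + a 0 * a 1) := by
    field_simp at hs
    have : ((m * (a 0 * a 1 * a 2) : ℕ) : ℚ) = (n * (a 1 * a 2 + a 0 * a 2 + a 0 * a 1) : ℕ) := by
      push_cast; linarith
    exact_mod_cast this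
  obtain ⟨h1, h2, h3⟩ := sols_bound m n (a 0) (a 1) (a 2) hn hm ha hb hc hab hbc key
  have hbig : a 2 ≤ n * (3 * n) * (2 * n * (3 * n)) :=
    calc a 2 ≤ n * a 0 * a 1 := h3
      _ ≤ n * a 0 * (2 * n * a 0) := Nat.mul_le_mul_left _ h2
      _ ≤ _ := by gcongr
  intro i
  fin_cases i
  · exact hab.trans (hbc.trans hbig)
  · exact hbc.trans hbig
  · exact hbig

open Finset in
lemma three_pow_le_card_divisors (n K : ℕ) (hK : K ≠ 0) (h : n ∣ K) :
    3 ^ #n.primeFactors ≤ #(K ^ 2).divisors := by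
  rw [Nat.card_divisors (by positivity), Nat.primeFactors_pow _ (by norm_num)]
  calc 3 ^ #n.primeFactors ≤ 3 ^ #K.primeFactors :=
        Nat.pow_le_pow_right (by norm_num) (card_le_card (Nat.primeFactors_mono h hK))
    _ ≤ _ := by
        refine Finset.pow_card_le_prod _ _ _ fun p hp => ?_
        have := (Nat.prime_of_mem_primeFactors hp).factorization_pos_of_dvd hK
          (Nat.dvd_of_mem_primeFactors hp)
        simp; omega

open Finset in
lemma card_divisors_le (K : ℕ) (hK : 0 < K) :
    #(K ^ 2).divisors ≤ 2 * #{d ∈ (K ^ 2).divisors | d ≤ K} := by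
  have h1 := card_filter_add_card_filter_not (s := (K ^ 2).divisors) (fun d => d ≤ K)
  have h2 : #{d ∈ (K ^ 2).divisors | ¬ d ≤ K} ≤ #{d ∈ (K ^ 2).divisors | d ≤ K} := by
    refine card_le_card_of_injOn (fun d => K ^ 2 / d) ?_ ?_
    · intro d hd
      simp only [coe_filter, Nat.mem_divisors, Set.mem_ofPred_eq] at hd ⊢
      refine ⟨⟨Nat.div_dvd_of_dvd hd.1.1, hd.1.2⟩, ?_⟩
      refine Nat.div_le_of_le_mul ?_
      nlinarith [hd.2]
    · intro d hd e he hde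
      simp only [coe_filter, Nat.mem_divisors, Set.mem_ofPred_eq] at hd he hde
      have h3 := Nat.div_div_self hd.1.1 hd.1.2
      have h4 := Nat.div_div_self he.1.1 he.1.2
      rw [← h3, ← h4, hde]
  omega

open Finset in
lemma numSols_lower (m n p : ℕ) (hm : 0 < m) (hn : 0 < n) (hp : p.Prime) (hpn : p ∣ n)
    (hpm : m ∣ p + 1) : 3 ^ #n.primeFactors ≤ 2 * numSols 3 m n := by
  obtain ⟨a, ha⟩ := hpm
  obtain ⟨r, rfl⟩ := hpn
  have hp0 := hp.pos
  have ha0 : 0 < a := by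
    rcases Nat.eq_zero_or_pos a with rfl | h
    · simp at ha
    · exact h
  have hr0 : 0 < r := Nat.pos_of_mul_pos_left hn
  set K := a * (p * r) with hKdef
  have hK : 0 < K := by positivity
  refine (three_pow_le_card_divisors (p * r) K hK.ne' (dvd_mul_left _ _)).trans
    ((card_divisors_le K hK).trans (Nat.mul_le_mul_left 2 ?_))
  have := sols_finite m (p * r) hn hm
  rw [numSols, ← Nat.card_eq_finsetCard]
  refine Nat.card_le_card_of_injective (fun d => ⟨![a * r, K + d.1, K + K ^ 2 / d.1], ?_, ?_, ?_⟩) ?_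
  · intro i
    fin_cases i
    · simp; exact ⟨ha0, hr0⟩
    · simp; omega
    · simp; omega
  · have hd := d.2
    rw [mem_filter, Nat.mem_divisors] at hd
    have hd0 : 0 < d.1 := Nat.pos_of_dvd_of_pos hd.1.1 (by positivity)
    have h1 : a * r ≤ K := by
      rw [hKdef]; exact Nat.mul_le_mul_left a (Nat.le_mul_of_pos_left r hp0)
    have h2 : d.1 ≤ K ^ 2 / d.1 := by
      rw [Nat.le_div_iff_mul_le hd0]
      nlinarith [hd.2]
    rw [Fin.monotone_iff_le_succ]
    intro i
    fin_cases i
    · simp; omega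
    · simp; omega
  · have hd := d.2
    rw [mem_filter, Nat.mem_divisors] at hd
    have hd0 : 0 < d.1 := Nat.pos_of_dvd_of_pos hd.1.1 (by positivity)
    obtain ⟨e, he⟩ := hd.1.1
    have hdiv : K ^ 2 / d.1 = e := Nat.div_eq_of_eq_mul_right hd0 he
    have he0 : 0 < e := by
      rcases Nat.eq_zero_or_pos e with rfl | h
      · simp at he; omega
      · exact h
    rw [hdiv, Fin.sum_univ_three]
    generalize d.1 = t at *
    simp only [Matrix.cons_val_zero, Matrix.cons_val_one, Matrix.cons_val]
    have hsplit : (1 : ℚ) / ((K + t : ℕ) : ℚ) + 1 / ((K + e : ℕ) : ℚ) = 1 / (K : ℚ) := by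
      have : (K : ℚ) ^ 2 = t * e := by exact_mod_cast he
      have hKq : (0 : ℚ) < K := by exact_mod_cast hK
      push_cast
      field_simp
      nlinarith
    rw [add_assoc, hsplit, hKdef]
    have haq : (p : ℚ) + 1 = m * a := by exact_mod_cast ha
    have : (0 : ℚ) < a := by exact_mod_cast ha0
    have : (0 : ℚ) < r := by exact_mod_cast hr0
    have : (0 : ℚ) < p := by exact_mod_cast hp0
    push_cast
    field_simp
    linarith
  · intro d e hde
    have := congrFun (congrArg Subtype.val hde) 1
    simp at this
    exact this


open Finset Filter in
lemma tendsto_class (m : ℕ) (hm : 0 < m) :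
    Tendsto (fun N : ℕ => ∑ p ∈ (Ioc 0 N).filter (fun p => p.Prime ∧ m ∣ p + 1), (1 : ℝ) / p)
      atTop atTop := by
  have : NeZero m := ⟨hm.ne'⟩
  have h := not_summable_inv_class (q := m) (a := -1) (isUnit_one.neg)
  rw [not_summable_iff_tendsto_nat_atTop_of_nonneg (fun n => by split_ifs <;> positivity)] at h
  have h2 := h.comp (tendsto_add_atTop_nat 1)
  refine h2.congr fun N => ?_
  simp only [Function.comp]
  rw [← sum_filter]
  refine sum_congr ?_ fun _ _ => rfl
  ext p
  simp only [mem_filter, mem_range, mem_Ioc]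
  have : (p : ZMod m) = -1 ↔ m ∣ p + 1 := by
    rw [← ZMod.natCast_eq_zero_iff, eq_neg_iff_add_eq_zero]
    push_cast; rfl
  rw [this]
  exact ⟨fun h => ⟨⟨h.2.1.pos, by omega⟩, h.2⟩, fun h => ⟨by omega, h.2⟩⟩

open Finset Filter in
lemma tendsto_loglog : Tendsto (fun N : ℕ => Real.log (Real.log N)) atTop atTop :=
  Real.tendsto_log_atTop.comp (Real.tendsto_log_atTop.comp tendsto_natCast_atTop_atTop)

open Finset Filter in
lemma tendsto_all :
    Tendsto (fun N : ℕ => ∑ p ∈ (Ioc 0 N).filter Nat.Prime, (1 : ℝ) / p) atTop atTop := by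
  refine tendsto_atTop_mono' atTop ?_ (tendsto_atTop_add_const_right atTop (-1) tendsto_loglog)
  filter_upwards [eventually_ge_atTop 3] with N hN
  have := mertens_lower N hN
  linarith

lemma final_ineq (ε : ℝ) (hε : 0 < ε) (hε' : ε ≤ Real.log 3) (L w A S : ℝ)
    (hL : 2 * (2 + Real.log 3) / ε ≤ L)
    (hA : L - 1 ≤ A) (hw : (1 - ε / (2 * Real.log 3)) * A < w)
    (hS : Real.exp (Real.log 3 * w) ≤ 2 * S) : Real.exp (L * (Real.log 3 - ε)) ≤ S := by
  have hl3 : 0 < Real.log 3 := Real.log_pos (by norm_num)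
  have h2 : (2 : ℝ) ≤ Real.exp 1 := by linarith [Real.add_one_le_exp (1 : ℝ)]
  have h1 : (Real.log 3 - ε / 2) * A < Real.log 3 * w := by
    have := mul_lt_mul_of_pos_left hw hl3
    have e : Real.log 3 * ((1 - ε / (2 * Real.log 3)) * A) = (Real.log 3 - ε / 2) * A := by
      field_simp
    linarith
  have h3 : (Real.log 3 - ε / 2) * (L - 1) ≤ (Real.log 3 - ε / 2) * A :=
    mul_le_mul_of_nonneg_left hA (by linarith)
  rw [div_le_iff₀ hε] at hL
  have h4 : 1 + L * (Real.log 3 - ε) ≤ Real.log 3 * w := by nlinarith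
  have h5 := Real.exp_le_exp.2 h4
  rw [Real.exp_add] at h5
  have := Real.exp_pos (L * (Real.log 3 - ε))
  nlinarith

open Finset Filter in
theorem stmt_8 (m : ℕ) (hm : 0 < m) (ε : ℝ) (hε : 0 < ε) :
    Filter.Tendsto
      (fun x : ℕ =>
        (Nat.card {n : ℕ | 0 < n ∧ n ≤ x ∧
          (Real.log n) ^ (Real.log 3 - ε) ≤ (numSols 3 m n : ℝ)} : ℝ) / (x : ℝ))
      Filter.atTop (nhds 1) := by
  classical
  have hl3 : 0 < Real.log 3 := Real.log_pos (by norm_num)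
  set η := min ε (Real.log 3) with hη
  have hη0 : 0 < η := lt_min hε hl3
  have hη1 : η ≤ Real.log 3 := min_le_right _ _
  have hη2 : η ≤ ε := min_le_left _ _
  set δ := η / (2 * Real.log 3) with hδ
  have hδ0 : 0 < δ := by positivity
  set A : ℕ → ℝ := fun N => ∑ p ∈ (Ioc 0 N).filter Nat.Prime, (1 : ℝ) / p with hA
  set B : ℕ → ℝ := fun N => ∑ p ∈ (Ioc 0 N).filter (fun p => p.Prime ∧ m ∣ p + 1), (1 : ℝ) / p with hB
  have hcard : ∀ x : ℕ, Nat.card {n : ℕ | 0 < n ∧ n ≤ x ∧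
          (Real.log n) ^ (Real.log 3 - ε) ≤ (numSols 3 m n : ℝ)} =
      #((Ioc 0 x).filter (fun n : ℕ => (Real.log n) ^ (Real.log 3 - ε) ≤ (numSols 3 m n : ℝ))) := by
    intro x
    rw [← Nat.card_eq_finsetCard]
    refine Nat.card_congr (Equiv.subtypeEquivRight fun n => ?_)
    simp [and_assoc]
  simp_rw [hcard]
  have hlim : Tendsto (fun x : ℕ => 1 - (2 / (x : ℝ) + 3 / 1 ^ 2 * (B x)⁻¹ + 3 / δ ^ 2 * (A x)⁻¹))
      atTop (nhds 1) := by
    have h1 : Tendsto (fun x : ℕ => 2 / (x : ℝ)) atTop (nhds 0) :=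
      tendsto_const_div_atTop_nhds_zero_nat 2
    have h2 := (tendsto_inv_atTop_zero.comp (tendsto_class m hm)).const_mul ((3 : ℝ) / 1 ^ 2)
    have h3 := (tendsto_inv_atTop_zero.comp tendsto_all).const_mul (3 / δ ^ 2)
    have h4 := ((h1.add h2).add h3).const_sub 1
    simp only [mul_zero, add_zero, sub_zero] at h4
    exact h4
  refine tendsto_of_tendsto_of_tendsto_of_le_of_le' hlim tendsto_const_nhds ?_ ?_
  · filter_upwards [eventually_ge_atTop 3, (tendsto_class m hm).eventually_gt_atTop 0,
      tendsto_all.eventually_gt_atTop 0,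
      tendsto_loglog.eventually_ge_atTop (2 * (2 + Real.log 3) / η)] with x hx hBx hAx hLx
    have hx0 : (0 : ℝ) < x := by exact_mod_cast (by omega : 0 < x)
    rw [le_div_iff₀ hx0]
    have c1 := turan_cheb x ((Ioc 0 x).filter (fun p => p.Prime ∧ m ∣ p + 1))
      (fun p hp => by rw [mem_filter, mem_Ioc] at hp; exact ⟨hp.2.1, hp.1.2⟩) 1 one_pos hBx
    have c2 := turan_cheb x ((Ioc 0 x).filter Nat.Prime)
      (fun p hp => by rw [mem_filter, mem_Ioc] at hp; exact ⟨hp.2, hp.1.2⟩) δ hδ0 hAx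
    have hcover : Ioc 0 x ⊆ {n ∈ Ioc 0 x | (Real.log n) ^ (Real.log 3 - ε) ≤ (numSols 3 m n : ℝ)} ∪
        (({1, 2} : Finset ℕ) ∪
        ({n ∈ Ioc 0 x | (#{p ∈ (Ioc 0 x).filter (fun p => p.Prime ∧ m ∣ p + 1) | p ∣ n} : ℝ)
          ≤ (1 - 1) * B x} ∪
        {n ∈ Ioc 0 x | (#{p ∈ (Ioc 0 x).filter Nat.Prime | p ∣ n} : ℝ) ≤ (1 - δ) * A x})) := by
      intro n hn
      by_contra hcon
      simp only [mem_union, mem_filter, hn, true_and, not_or, not_le, mem_insert,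
        mem_singleton] at hcon
      obtain ⟨g1, ⟨g2, g3⟩, g4, g5⟩ := hcon
      refine absurd g1 (not_lt.2 ?_)
      rw [mem_Ioc] at hn
      have hn3 : 3 ≤ n := by omega
      rw [sub_self, zero_mul, Nat.cast_pos, card_pos] at g4
      obtain ⟨p, hp⟩ := g4
      rw [mem_filter, mem_filter] at hp
      have hS := numSols_lower m n p hm hn.1 hp.1.2.1 hp.2 hp.1.2.2
      have hpf : ((Ioc 0 x).filter Nat.Prime).filter (fun p => p ∣ n) = n.primeFactors := by
        ext q
        simp only [mem_filter, mem_Ioc, Nat.mem_primeFactors]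
        constructor
        · rintro ⟨⟨_, h1⟩, h2⟩
          exact ⟨h1, h2, by omega⟩
        · rintro ⟨h1, h2, _⟩
          exact ⟨⟨⟨h1.pos, (Nat.le_of_dvd hn.1 h2).trans hn.2⟩, h1⟩, h2⟩
      rw [hpf] at g5
      have hS' : Real.exp (Real.log 3 * (#n.primeFactors : ℝ)) ≤ 2 * (numSols 3 m n : ℝ) := by
        rw [← Real.rpow_def_of_pos (by norm_num), Real.rpow_natCast]
        exact_mod_cast hS
      have hfin := final_ineq η hη0 hη1 _ _ _ _ hLx (mertens_lower x hx) g5 hS'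
      have hlogn : 1 ≤ Real.log n := by
        rw [Real.le_log_iff_exp_le (by positivity)]
        have : (3 : ℝ) ≤ n := by exact_mod_cast hn3
        linarith [Real.exp_one_lt_d9]
      have hlogx : Real.log n ≤ Real.log x :=
        Real.log_le_log (by positivity) (by exact_mod_cast hn.2)
      calc (Real.log n) ^ (Real.log 3 - ε) ≤ (Real.log n) ^ (Real.log 3 - η) :=
            Real.rpow_le_rpow_of_exponent_le hlogn (by linarith)
        _ ≤ (Real.log x) ^ (Real.log 3 - η) :=
            Real.rpow_le_rpow (by linarith) hlogx (by linarith)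
        _ = Real.exp (Real.log (Real.log x) * (Real.log 3 - η)) :=
            Real.rpow_def_of_pos (by linarith) _
        _ ≤ _ := hfin
    have hle := (card_le_card hcover).trans ((card_union_le _ _).trans (Nat.add_le_add_left
      ((card_union_le _ _).trans (Nat.add_le_add card_le_two (card_union_le _ _))) _))
    rw [Nat.card_Ioc, tsub_zero] at hle
    have hle' : (x : ℝ) ≤ _ := Nat.cast_le.2 hle
    push_cast at hle'
    have e : (1 - (2 / (x : ℝ) + 3 / 1 ^ 2 * (B x)⁻¹ + 3 / δ ^ 2 * (A x)⁻¹)) * x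
        = x - 2 - x * (3 / 1 ^ 2 * (B x)⁻¹) - x * (3 / δ ^ 2 * (A x)⁻¹) := by
      field_simp
      ring
    rw [e]
    simp only [hA, hB] at hle' ⊢
    linarith
  · filter_upwards with x
    refine div_le_one_of_le₀ ?_ (by positivity)
    have := card_filter_le (Ioc 0 x)
      (fun n => (Real.log n) ^ (Real.log 3 - ε) ≤ (numSols 3 m n : ℝ))
    rw [Nat.card_Ioc, tsub_zero] at this
    exact_mod_cast this
end
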